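/- In any public decision making instance with n players and m issues, for every player i the chain of inequalities PPS_i ≤ RRS_i ≤ Prop_i holds; consequently any outcome satisfying Prop satisfies RRS, and any outcome satisfying RRS satisfies PPS. -/

import Mathlib

open Finset

structure PubInst (n m : ℕ) where
  A : Fin m → Type
  fin : ∀ t, Fintype (A t)
  nonempty : ∀ t, Nonempty (A t)
  u : Fin n → (t : Fin m) → A t → ℝ
  nonneg : ∀ i t a, 0 ≤ u i t a

namespace PubInst

variable {n m : ℕ}

/-- An outcome chooses one alternative per issue. -/
def Outcome (I : PubInst n m) : Type := (t : Fin m) → I.A t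

/-- Utility of player `i` under outcome `c`. -/
noncomputable def util (I : PubInst n m) (c : I.Outcome) (i : Fin n) : ℝ :=
  ∑ t : Fin m, I.u i t (c t)

/-- Maximum utility player `i` can derive from issue `t`. -/
noncomputable def umax (I : PubInst n m) (i : Fin n) (t : Fin m) : ℝ :=
  letI := I.fin t
  Finset.univ.sup' (Finset.univ_nonempty_iff.mpr (I.nonempty t)) (I.u i t)

/-- Values of `f` sorted in non-increasing order: `sortedDesc f r` is the `(r+1)`-th largest. -/
noncomputable def sortedDesc (f : Fin m → ℝ) : Fin m → ℝ :=
  fun r => f (Tuple.sort (fun j => -f j) r)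

noncomputable def propShare (I : PubInst n m) (i : Fin n) : ℝ :=
  (1 / (n : ℝ)) * ∑ t : Fin m, I.umax i t

noncomputable def RRS (I : PubInst n m) (i : Fin n) : ℝ :=
  ∑ r : Fin m,
    if n ∣ (r.val + 1) ∧ r.val + 1 ≤ (m / n) * n then sortedDesc (I.umax i) r else 0

noncomputable def PPS (I : PubInst n m) (i : Fin n) : ℝ :=
  ∑ r : Fin m, if m - m / n ≤ r.val then sortedDesc (I.umax i) r else 0

def ParetoOptimal (I : PubInst n m) (c : I.Outcome) : Prop :=
  ¬ ∃ c' : I.Outcome, (∀ i, I.util c i ≤ I.util c' i) ∧ ∃ j, I.util c j < I.util c' j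

def MNW (I : PubInst n m) (c : I.Outcome) : Prop :=
  (∀ c' : I.Outcome,
      (Finset.univ.filter fun i => 0 < I.util c' i).card ≤
        (Finset.univ.filter fun i => 0 < I.util c i).card) ∧
  (∀ c' : I.Outcome,
      (∏ i ∈ Finset.univ.filter fun i => 0 < I.util c i, I.util c' i) ≤
        ∏ i ∈ Finset.univ.filter fun i => 0 < I.util c i, I.util c i)

end PubInst

namespace PubInst

variable {n m : ℕ}

theorem umax_nonneg (I : PubInst n m) (i : Fin n) (t : Fin m) : 0 ≤ I.umax i t := by
  let := I.fin t
  obtain ⟨a⟩ := I.nonempty t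
  exact (I.nonneg i t a).trans (Finset.le_sup' (I.u i t) (Finset.mem_univ a))

theorem sortedDesc_antitone (f : Fin m → ℝ) : Antitone (sortedDesc f) := fun _ _ h =>
  neg_le_neg_iff.mp (Tuple.monotone_sort (fun j => -f j) h)

theorem sum_sortedDesc (f : Fin m → ℝ) : ∑ r, sortedDesc f r = ∑ t, f t :=
  Equiv.sum_comp (Tuple.sort fun j => -f j) f

/-- The sequence `sortedDesc f`, extended by zero to all natural numbers. -/
noncomputable def sortedSeq (f : Fin m → ℝ) (k : ℕ) : ℝ :=
  if h : k < m then sortedDesc f ⟨k, h⟩ else 0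

theorem sortedSeq_val (f : Fin m → ℝ) (r : Fin m) : sortedSeq f r.val = sortedDesc f r := by
  simp [sortedSeq]

theorem sortedSeq_nonneg {f : Fin m → ℝ} (hf : ∀ t, 0 ≤ f t) (k : ℕ) : 0 ≤ sortedSeq f k := by
  unfold sortedSeq
  split_ifs
  · exact hf _
  · exact le_rfl

theorem sortedSeq_antitone {f : Fin m → ℝ} (hf : ∀ t, 0 ≤ f t) : Antitone (sortedSeq f) := by
  intro a b hab
  by_cases hb : b < m
  · have ha : a < m := hab.trans_lt hb
    simpa [sortedSeq, ha, hb] using sortedDesc_antitone f (a := ⟨a, ha⟩) (b := ⟨b, hb⟩) hab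
  · simpa [sortedSeq, hb] using sortedSeq_nonneg hf a

theorem sum_ite_sortedDesc (f : Fin m → ℝ) (P : ℕ → Prop) [DecidablePred P] :
    ∑ r : Fin m, (if P r.val then sortedDesc f r else 0) =
      ∑ r ∈ (Finset.range m).filter P, sortedSeq f r := by
  rw [Finset.sum_filter, ← Fin.sum_univ_eq_sum_range (fun k => if P k then sortedSeq f k else 0)]
  simp only [sortedSeq_val]

theorem RRS_eq_sum_range (I : PubInst n m) (i : Fin n) :
    I.RRS i = ∑ k ∈ Finset.range (m / n), sortedSeq (I.umax i) ((k + 1) * n - 1) := by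
  have hn : 0 < n := i.pos
  unfold RRS
  rw [sum_ite_sortedDesc (I.umax i) fun r => n ∣ r + 1 ∧ r + 1 ≤ m / n * n]
  symm
  refine Finset.sum_nbij (fun k => (k + 1) * n - 1) ?_ ?_ ?_ fun _ _ => rfl
  · intro k hk
    have hk' : (k + 1) * n ≤ m / n * n := Nat.mul_le_mul_right n (Finset.mem_range.mp hk)
    have hm := Nat.div_mul_le_self m n
    have hpos : 0 < (k + 1) * n := by positivity
    have hsub : (k + 1) * n - 1 + 1 = (k + 1) * n := by omega
    simp only [Finset.mem_filter, Finset.mem_range, hsub]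
    exact ⟨by omega, Dvd.intro_left _ rfl, hk'⟩
  · intro a _ b _ hab
    have ha : 0 < (a + 1) * n := by positivity
    have hb : 0 < (b + 1) * n := by positivity
    have h : (a + 1) * n = (b + 1) * n := by
      simp only at hab
      omega
    simpa using Nat.eq_of_mul_eq_mul_right hn h
  · intro r hr
    simp only [Finset.coe_filter, Finset.mem_range, Set.mem_ofPred_eq] at hr
    obtain ⟨-, ⟨q, hq⟩, hle⟩ := hr
    obtain ⟨k, rfl⟩ : ∃ k, q = k + 1 := Nat.exists_eq_succ_of_ne_zero (by rintro rfl; simp at hq)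
    rw [mul_comm] at hq
    rw [hq] at hle
    exact ⟨k, by simpa using Nat.le_of_mul_le_mul_right hle hn, by simp only; omega⟩

theorem PPS_eq_sum_range (I : PubInst n m) (i : Fin n) :
    I.PPS i = ∑ k ∈ Finset.range (m / n), sortedSeq (I.umax i) (m - m / n + k) := by
  have hm := Nat.div_le_self m n
  unfold PPS
  rw [sum_ite_sortedDesc (I.umax i) fun r => m - m / n ≤ r]
  symm
  refine Finset.sum_nbij (fun k => m - m / n + k) ?_ ?_ ?_ fun _ _ => rfl
  · intro k hk
    simp only [Finset.mem_filter, Finset.mem_range] at hk ⊢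
    omega
  · intro a _ b _ hab
    exact Nat.add_left_cancel hab
  · intro r hr
    simp only [Finset.coe_filter, Finset.mem_range, Set.mem_ofPred_eq] at hr
    exact ⟨r - (m - m / n), by simp only [Finset.coe_range, Set.mem_Iio]; omega,
      by simp only; omega⟩

theorem PPS_le_RRS (I : PubInst n m) (i : Fin n) : I.PPS i ≤ I.RRS i := by
  rw [PPS_eq_sum_range, RRS_eq_sum_range]
  refine Finset.sum_le_sum fun k hk => sortedSeq_antitone (I.umax_nonneg i) ?_
  obtain ⟨l, rfl⟩ : ∃ l, n = l + 1 := Nat.exists_eq_succ_of_ne_zero i.pos.ne'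
  have hkl : (k + 1) * l ≤ m / (l + 1) * l := Nat.mul_le_mul_right l (Finset.mem_range.mp hk)
  have hm := Nat.div_mul_le_self m (l + 1)
  rw [mul_add_one] at hm ⊢
  omega

theorem sum_block_last_le {G : ℕ → ℝ} (hG : Antitone G) (n p : ℕ) :
    n * ∑ k ∈ Finset.range p, G ((k + 1) * n - 1) ≤ ∑ r ∈ Finset.range (p * n), G r := by
  induction p with
  | zero => simp
  | succ p ih =>
    have hblock : n * G ((p + 1) * n - 1) ≤ ∑ j ∈ Finset.range n, G (p * n + j) := by
      simpa using Finset.card_nsmul_le_sum (Finset.range n) (fun j => G (p * n + j))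
        (G ((p + 1) * n - 1)) fun j hj => hG (by
          have := Finset.mem_range.mp hj
          rw [add_one_mul]
          omega)
    rw [Finset.sum_range_succ, mul_add, add_one_mul p n, Finset.sum_range_add, ← add_one_mul]
    exact add_le_add ih hblock

theorem RRS_le_propShare (I : PubInst n m) (i : Fin n) : I.RRS i ≤ I.propShare i := by
  have hn : (0 : ℝ) < n := Nat.cast_pos.mpr i.pos
  have hsum : ∑ t, I.umax i t = ∑ r ∈ Finset.range m, sortedSeq (I.umax i) r := by
    rw [← sum_sortedDesc, ← Fin.sum_univ_eq_sum_range]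
    simp only [sortedSeq_val]
  rw [RRS_eq_sum_range, propShare, hsum, one_div, le_inv_mul_iff₀ hn]
  refine (sum_block_last_le (sortedSeq_antitone (I.umax_nonneg i)) n (m / n)).trans ?_
  exact Finset.sum_le_sum_of_subset_of_nonneg
    (Finset.range_subset_range.mpr (Nat.div_mul_le_self m n))
    fun r _ _ => sortedSeq_nonneg (I.umax_nonneg i) r

end PubInst

/-- In any public decision making instance, `PPS_i ≤ RRS_i ≤ Prop_i`
for every player `i`; consequently, any outcome satisfying Prop satisfies RRS, and any
outcome satisfying RRS satisfies PPS. -/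
theorem PPS_le_RRS_le_Prop {n m : ℕ} (hn : 1 ≤ n) (I : PubInst n m) :
    (∀ i : Fin n, I.PPS i ≤ I.RRS i ∧ I.RRS i ≤ I.propShare i) ∧
    (∀ c : I.Outcome, (∀ i, I.propShare i ≤ I.util c i) → ∀ i, I.RRS i ≤ I.util c i) ∧
    (∀ c : I.Outcome, (∀ i, I.RRS i ≤ I.util c i) → ∀ i, I.PPS i ≤ I.util c i) := by
  exact ⟨fun i => ⟨I.PPS_le_RRS i, I.RRS_le_propShare i⟩,
    fun _ h i => (I.RRS_le_propShare i).trans (h i),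
    fun _ h i => (I.PPS_le_RRS i).trans (h i)⟩
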